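/- arXiv:2208.03512 — 10 statements merged into one kernel-verified Lean document; each statement's English description precedes it below -/
import Mathlib

section
/- Let g : [0,1] × (0,∞) → [0,1] be such that for every η > 0 the map p ↦ g(p,η) is continuous, strictly increasing, strictly concave on [0,1], differentiable from the right at 0 with derivative d(η), and satisfies g(0,η) = 0 and g(1,η) < 1. Assume moreover that η ↦ d(η) is strictly increasing on (0,∞). Then there exists η_c ∈ [0,∞] such that for every η > 0: if η < η_c then p = 0 is the unique solution in [0,1] of g(p,η) = p, and if η > η_c then there are exactly two solutions in [0,1], namely 0 and a unique p*(η) ∈ (0,1). -/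
/-- Strict concavity with `f 0 = 0`: below a positive fixed point, `f` is above the diagonal. -/
lemma above_diag (f : ℝ → ℝ) (hconc : StrictConcaveOn ℝ (Set.Icc 0 1) f) (h0 : f 0 = 0)
    {p q : ℝ} (hp : 0 < p) (hpq : p < q) (hq : q ≤ 1) (hfix : f q = q) : p < f p := by
  have hq0 : 0 < q := hp.trans hpq
  have h := hconc.2 (show (0:ℝ) ∈ Set.Icc (0:ℝ) 1 from ⟨le_rfl, zero_le_one⟩)
    (show q ∈ Set.Icc (0:ℝ) 1 from ⟨hq0.le, hq⟩) hq0.ne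
    (show 0 < 1 - p / q by rw [sub_pos, div_lt_one hq0]; exact hpq)
    (show 0 < p / q by positivity) (by ring)
  simp only [smul_eq_mul, h0, hfix, mul_zero, zero_add] at h
  rwa [div_mul_cancel₀ _ hq0.ne'] at h

lemma no_fixed (f : ℝ → ℝ) (f' : ℝ) (hconc : StrictConcaveOn ℝ (Set.Icc 0 1) f)
    (hd : HasDerivWithinAt f f' (Set.Icc 0 1) 0) (h0 : f 0 = 0) (hf' : f' ≤ 1)
    {p : ℝ} (hp : p ∈ Set.Icc (0:ℝ) 1) (hfix : f p = p) : p = 0 := by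
  by_contra hne
  have hp0 : 0 < p := lt_of_le_of_ne hp.1 (Ne.symm hne)
  have h := above_diag f hconc h0 (half_pos hp0) (half_lt_self hp0) hp.2 hfix
  have hs := hconc.concaveOn.slope_le_of_hasDerivWithinAt (x := 0) (y := p / 2)
    ⟨le_rfl, zero_le_one⟩ ⟨by linarith, by linarith [hp.2]⟩ (half_pos hp0) hd
  rw [slope_def_field, h0, sub_zero, sub_zero, div_le_iff₀ (half_pos hp0)] at hs
  nlinarith

lemma exists_fixed (f : ℝ → ℝ) (f' : ℝ) (hcont : ContinuousOn f (Set.Icc 0 1))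
    (hd : HasDerivWithinAt f f' (Set.Icc 0 1) 0) (h0 : f 0 = 0) (h1 : f 1 < 1) (hf' : 1 < f') :
    ∃ p ∈ Set.Ioo (0:ℝ) 1, f p = p := by
  have hd2 : HasDerivWithinAt f f' (Set.Ioo 0 1) 0 := hd.mono Set.Ioo_subset_Icc_self
  rw [hasDerivWithinAt_iff_tendsto_slope' (by simp), nhdsWithin_Ioo_eq_nhdsGT zero_lt_one] at hd2
  have hev := (hd2.eventually (lt_mem_nhds hf')).and (Ioo_mem_nhdsGT (zero_lt_one' ℝ))
  obtain ⟨q, hq, hq0, hq1⟩ := hev.exists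
  rw [slope_def_field, h0, sub_zero, sub_zero, lt_div_iff₀ hq0, one_mul] at hq
  have hc : ContinuousOn (fun p => f p - p) (Set.Icc q 1) :=
    (hcont.mono (Set.Icc_subset_Icc_left hq0.le)).sub continuousOn_id
  obtain ⟨p, hp, hpe⟩ := intermediate_value_Ioo' hq1.le hc
    (show (0:ℝ) ∈ Set.Ioo (f 1 - 1) (f q - q) from ⟨by linarith, by linarith⟩)
  exact ⟨p, ⟨hq0.trans hp.1, hp.2⟩, by simpa [sub_eq_zero] using hpe⟩

/-- For a two-parameter family `g (p, η)` which for every `η > 0` is (in `p`)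
continuous, strictly increasing, strictly concave on `[0,1]`, differentiable from the right
at `0` with derivative `d η`, with `g 0 η = 0` and `g 1 η < 1`, and such that `d` is strictly
increasing on `(0,∞)`, there exists `η_c ∈ [0,∞]` such that for every `η > 0`:
if `η < η_c` then `p = 0` is the unique fixed point in `[0,1]`, and if `η > η_c` there are
exactly two fixed points, `0` and a unique `p*(η) ∈ (0,1)`. -/
theorem stmt1 (g : ℝ → ℝ → ℝ) (d : ℝ → ℝ)
    (hmap : ∀ η > (0:ℝ), ∀ p ∈ Set.Icc (0:ℝ) 1, g p η ∈ Set.Icc (0:ℝ) 1)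
    (hcont : ∀ η > (0:ℝ), ContinuousOn (fun p => g p η) (Set.Icc 0 1))
    (hmono : ∀ η > (0:ℝ), StrictMonoOn (fun p => g p η) (Set.Icc 0 1))
    (hconc : ∀ η > (0:ℝ), StrictConcaveOn ℝ (Set.Icc 0 1) (fun p => g p η))
    (hdiff : ∀ η > (0:ℝ), ∀ p ∈ Set.Ico (0:ℝ) 1,
      DifferentiableWithinAt ℝ (fun p => g p η) (Set.Icc 0 1) p)
    (hd : ∀ η > (0:ℝ), HasDerivWithinAt (fun p => g p η) (d η) (Set.Icc 0 1) 0)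
    (h0 : ∀ η > (0:ℝ), g 0 η = 0) (h1 : ∀ η > (0:ℝ), g 1 η < 1)
    (hdmono : StrictMonoOn d (Set.Ioi 0)) :
    ∃ ηc : EReal, 0 ≤ ηc ∧ ∀ η > (0:ℝ),
      ((η : EReal) < ηc → ∀ p ∈ Set.Icc (0:ℝ) 1, g p η = p → p = 0) ∧
      (ηc < (η : EReal) →
        (∃! p, p ∈ Set.Ioo (0:ℝ) 1 ∧ g p η = p) ∧
        (∀ p ∈ Set.Icc (0:ℝ) 1, g p η = p → p = 0 ∨ p ∈ Set.Ioo (0:ℝ) 1)) := by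
  refine ⟨sInf ((fun x : ℝ => (x : EReal)) '' {η : ℝ | 0 < η ∧ 1 < d η}), ?_, ?_⟩
  · apply le_sInf
    rintro _ ⟨x, hx, rfl⟩
    exact EReal.coe_nonneg.mpr hx.1.le
  intro η hη
  constructor
  · intro hlt p hp hfix
    refine no_fixed _ (d η) (hconc η hη) (hd η hη) (h0 η hη) ?_ hp hfix
    by_contra hcon
    exact absurd hlt (not_lt.mpr (sInf_le ⟨η, ⟨hη, not_le.mp hcon⟩, rfl⟩))
  · intro hlt
    obtain ⟨_, ⟨x, hx, rfl⟩, hxη⟩ := sInf_lt_iff.mp hlt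
    have hxη' : x < η := EReal.coe_lt_coe_iff.mp hxη
    have hdη : 1 < d η := hx.2.trans (hdmono hx.1 hη hxη')
    refine ⟨?_, ?_⟩
    · obtain ⟨p, hp, hfix⟩ :=
        exists_fixed _ (d η) (hcont η hη) (hd η hη) (h0 η hη) (h1 η hη) hdη
      refine ⟨p, ⟨hp, hfix⟩, ?_⟩
      rintro q ⟨hq, hqfix⟩
      rcases lt_trichotomy q p with h | h | h
      · have := above_diag _ (hconc η hη) (h0 η hη) hq.1 h hp.2.le hfix
        exact absurd hqfix this.ne'
      · exact h
      · have := above_diag _ (hconc η hη) (h0 η hη) hp.1 h hq.2.le hqfix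
        exact absurd hfix this.ne'
    · intro p hp hfix
      rcases eq_or_lt_of_le hp.1 with h | h
      · exact Or.inl h.symm
      · refine Or.inr ⟨h, lt_of_le_of_ne hp.2 ?_⟩
        rintro rfl
        exact absurd hfix (h1 η hη).ne
end

section
/- Let λ, μ, α, β > 0, q ∈ [0,1], and let x, y ≥ 0 satisfy x + y = λ/μ and λq ≤ μx − βy + αxy. Then the discriminant Δ := (μ + β + αλ/μ)² − 4αλ(q + β/μ) is nonnegative, and x ≥ (μ + β + αλ/μ − √Δ) / (2α). -/
/-- Let `λ, μ, α, β > 0`, `q ∈ [0,1]`, and let `x, y ≥ 0` satisfy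
`x + y = λ/μ` and `λq ≤ μx − βy + αxy`. Then the discriminant
`Δ = (μ + β + αλ/μ)² − 4αλ(q + β/μ)` is nonnegative, and
`x ≥ (μ + β + αλ/μ − √Δ) / (2α)`. -/
theorem stmt3 (lam mu alpha beta q x y : ℝ)
    (hlam : 0 < lam) (hmu : 0 < mu) (halpha : 0 < alpha) (hbeta : 0 < beta)
    (hq0 : 0 ≤ q) (hq1 : q ≤ 1)
    (hx : 0 ≤ x) (hy : 0 ≤ y)
    (hsum : x + y = lam / mu)
    (hineq : lam * q ≤ mu * x - beta * y + alpha * x * y) :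
    0 ≤ (mu + beta + alpha * lam / mu) ^ 2 - 4 * alpha * lam * (q + beta / mu) ∧
    (mu + beta + alpha * lam / mu -
        Real.sqrt ((mu + beta + alpha * lam / mu) ^ 2 - 4 * alpha * lam * (q + beta / mu))) /
      (2 * alpha) ≤ x := by
  have e1 : alpha * lam / mu = alpha * (x + y) := by rw [hsum]; ring
  have e2 : 4 * alpha * lam * (q + beta / mu)
      = 4 * alpha * (lam * q) + 4 * alpha * (beta * (x + y)) := by rw [hsum]; ring
  have key : (mu + beta + alpha * lam / mu - 2 * alpha * x) ^ 2
      ≤ (mu + beta + alpha * lam / mu) ^ 2 - 4 * alpha * lam * (q + beta / mu) := by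
    rw [e1, e2]
    have h := mul_le_mul_of_nonneg_left hineq halpha.le
    linarith
  refine ⟨le_trans (sq_nonneg _) key, ?_⟩
  have h2 := Real.le_sqrt_of_sq_le key
  rw [div_le_iff₀ (by positivity)]
  linarith
end

section
/- Let λ, μ, α, β > 0, p ∈ [0,1], and let x, y ≥ 0 satisfy x + y = λ/μ, y = pλ/μ, and βy ≤ α(xy + λ/(2μ)). Then p ≤ (λ/μ − β/α + √((λ/μ − β/α)² + 2λ/μ)) / (2λ/μ). -/
/-- Let `λ, μ, α, β > 0`, `p ∈ [0,1]`, and `x, y ≥ 0` with `x + y = λ/μ`,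
`y = pλ/μ`, and `βy ≤ α(xy + λ/(2μ))`. Then
`p ≤ (λ/μ − β/α + √((λ/μ − β/α)² + 2λ/μ)) / (2λ/μ)`. -/
theorem stmt5 (lam mu alpha beta p x y : ℝ)
    (hlam : 0 < lam) (hmu : 0 < mu) (halpha : 0 < alpha) (hbeta : 0 < beta)
    (hp0 : 0 ≤ p) (hp1 : p ≤ 1)
    (hx : 0 ≤ x) (hy : 0 ≤ y)
    (hsum : x + y = lam / mu) (hyp : y = p * lam / mu)
    (hineq : beta * y ≤ alpha * (x * y + lam / (2 * mu))) :
    p ≤ (lam / mu - beta / alpha +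
        Real.sqrt ((lam / mu - beta / alpha) ^ 2 + 2 * (lam / mu))) / (2 * (lam / mu)) := by
  have hr : 0 < lam / mu := div_pos hlam hmu
  have hy' : y = p * (lam / mu) := by rw [hyp, mul_div_assoc]
  have hh : lam / (2 * mu) = (lam / mu) / 2 := by field_simp
  have hb : beta = alpha * (beta / alpha) := by field_simp
  rw [hh] at hineq
  generalize lam / mu = r at *
  generalize beta / alpha = b at *
  have h1 : b * y ≤ x * y + r / 2 := by
    rw [hb, mul_assoc] at hineq
    exact le_of_mul_le_mul_left hineq halpha
  have hxe : x = r - y := by linarith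
  rw [hxe] at h1
  have h2 : 2 * y - (r - b) ≤ Real.sqrt ((r - b) ^ 2 + 2 * r) := by
    apply Real.le_sqrt_of_sq_le
    nlinarith
  rw [le_div_iff₀ (by linarith)]
  linarith
end

section
/- Let λ, μ, α, β > 0, p ∈ (0,1], q = 1 − p, and set η = λ/μ. Then the discriminant Δ := (μ + β + αη)² − 4αλ(q + β/μ) is strictly positive; the quadratic equation αx² − (μ + β + αη)x + λq + βη = 0 has two real roots, the larger of which is strictly greater than η; and consequently any x ∈ [0, η] satisfying λq = μx − β(η − x) + αx(η − x) must equal (μ + β + αη − √Δ)/(2α). -/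
/-- Let `λ, μ, α, β > 0`, `p ∈ (0,1]`, `q = 1 − p`, `η = λ/μ`. Then
`Δ := (μ + β + αη)² − 4αλ(q + β/μ) > 0`; the quadratic
`αx² − (μ + β + αη)x + λq + βη = 0` has the two real roots
`r₁ = (μ + β + αη − √Δ)/(2α)` and `r₂ = (μ + β + αη + √Δ)/(2α)` with `r₁ < r₂` and
`η < r₂`; and any `x ∈ [0, η]` with `λq = μx − β(η − x) + αx(η − x)` equals `r₁`. -/
theorem stmt6 (lam mu alpha beta p q eta : ℝ)
    (hlam : 0 < lam) (hmu : 0 < mu) (halpha : 0 < alpha) (hbeta : 0 < beta)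
    (hp0 : 0 < p) (hp1 : p ≤ 1) (hq : q = 1 - p) (heta : eta = lam / mu) :
    0 < (mu + beta + alpha * eta) ^ 2 - 4 * alpha * lam * (q + beta / mu) ∧
    (alpha * ((mu + beta + alpha * eta -
          Real.sqrt ((mu + beta + alpha * eta) ^ 2 - 4 * alpha * lam * (q + beta / mu))) /
          (2 * alpha)) ^ 2 -
        (mu + beta + alpha * eta) *
          ((mu + beta + alpha * eta -
            Real.sqrt ((mu + beta + alpha * eta) ^ 2 - 4 * alpha * lam * (q + beta / mu))) /
            (2 * alpha)) + lam * q + beta * eta = 0) ∧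
    (alpha * ((mu + beta + alpha * eta +
          Real.sqrt ((mu + beta + alpha * eta) ^ 2 - 4 * alpha * lam * (q + beta / mu))) /
          (2 * alpha)) ^ 2 -
        (mu + beta + alpha * eta) *
          ((mu + beta + alpha * eta +
            Real.sqrt ((mu + beta + alpha * eta) ^ 2 - 4 * alpha * lam * (q + beta / mu))) /
            (2 * alpha)) + lam * q + beta * eta = 0) ∧
    ((mu + beta + alpha * eta -
        Real.sqrt ((mu + beta + alpha * eta) ^ 2 - 4 * alpha * lam * (q + beta / mu))) /
        (2 * alpha) <
      (mu + beta + alpha * eta +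
        Real.sqrt ((mu + beta + alpha * eta) ^ 2 - 4 * alpha * lam * (q + beta / mu))) /
        (2 * alpha)) ∧
    (eta <
      (mu + beta + alpha * eta +
        Real.sqrt ((mu + beta + alpha * eta) ^ 2 - 4 * alpha * lam * (q + beta / mu))) /
        (2 * alpha)) ∧
    (∀ x : ℝ, 0 ≤ x → x ≤ eta →
      lam * q = mu * x - beta * (eta - x) + alpha * x * (eta - x) →
      x = (mu + beta + alpha * eta -
          Real.sqrt ((mu + beta + alpha * eta) ^ 2 - 4 * alpha * lam * (q + beta / mu))) /
          (2 * alpha)) := by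
  have hme : mu * eta = lam := by rw [heta]; field_simp
  have hD : (mu + beta + alpha * eta) ^ 2 - 4 * alpha * lam * (q + beta / mu)
      = (mu + beta + alpha * eta) ^ 2 - 4 * alpha * (lam * q + beta * eta) := by
    rw [heta]; field_simp
  rw [hD]
  have hD2 : (mu + beta + alpha * eta) ^ 2 - 4 * alpha * (lam * q + beta * eta)
      = (2 * alpha * eta - (mu + beta + alpha * eta)) ^ 2 + 4 * (alpha * (lam * p)) := by
    rw [hq, ← hme]; ring
  have hpos : 0 < alpha * (lam * p) := by positivity
  have hDpos : 0 < (mu + beta + alpha * eta) ^ 2 - 4 * alpha * (lam * q + beta * eta) := by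
    rw [hD2]; positivity
  have hs := Real.sq_sqrt hDpos.le
  have hs0 := Real.sqrt_pos.2 hDpos
  have hlt : 2 * alpha * eta - (mu + beta + alpha * eta) <
      Real.sqrt ((mu + beta + alpha * eta) ^ 2 - 4 * alpha * (lam * q + beta * eta)) := by
    apply Real.lt_sqrt_of_sq_lt
    rw [hD2]; linarith
  generalize Real.sqrt ((mu + beta + alpha * eta) ^ 2 - 4 * alpha * (lam * q + beta * eta)) = s
    at hs hs0 hlt ⊢
  generalize hB : mu + beta + alpha * eta = B at *
  refine ⟨hDpos, ?_, ?_, ?_, ?_, ?_⟩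
  · field_simp
    linear_combination hs
  · field_simp
    linear_combination hs
  · gcongr
    linarith
  · rw [lt_div_iff₀ (by positivity)]
    linarith
  · intro x _ hx h
    have h2 : (2 * alpha * x - B - s) * (2 * alpha * x - B + s) = 0 := by
      linear_combination (4 * alpha) * h - hs + 4 * alpha * x * hB
    rcases mul_eq_zero.1 h2 with h3 | h3
    · have := mul_le_mul_of_nonneg_left hx halpha.le
      linarith
    · rw [eq_div_iff (by positivity)]
      linarith
end

section
/- Let λ, μ, ν, α > 0, p ∈ [0,1], q = 1 − p, θ = λp/ν, y* = ν/(ν+α), h(y) = (λp(1−y) + μ)/(ν(1−y) − αy), g(y) = λq·e^{−θ(1−y)}/(ν(1−y) − αy). Then the function u ↦ g(u)·exp(∫_u^1 h(z) dz) is integrable on (y*, 1), and any bounded differentiable Ψ : (y*, 1] → ℝ satisfying Ψ'(y) = h(y)·Ψ(y) − g(y) on (y*, 1] has Ψ(1) = −∫_{y*}^{1} g(u)·exp(∫_u^1 h(z) dz) du. -/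
open MeasureTheory intervalIntegral

/-- The coefficient `h(y) = (λp(1−y) + μ)/(ν(1−y) − αy)` of the DOCS reactor ODE. -/
noncomputable def docsH (lam mu nu alpha p : ℝ) (y : ℝ) : ℝ :=
  (lam * p * (1 - y) + mu) / (nu * (1 - y) - alpha * y)

/-- The inhomogeneity `g(y) = λq·e^{−θ(1−y)}/(ν(1−y) − αy)`, `θ = λp/ν`, of the DOCS ODE. -/
noncomputable def docsG (lam nu alpha p q : ℝ) (y : ℝ) : ℝ :=
  lam * q * Real.exp (-(lam * p / nu) * (1 - y)) / (nu * (1 - y) - alpha * y)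

/-- Closed form of the integrating factor. -/
noncomputable def docsF (s k c : ℝ) (u : ℝ) : ℝ :=
  ((u - s) / (1 - s)) ^ k * Real.exp (c * (1 - u))

lemma docsF_cont (s k c : ℝ) (hk : 0 < k) : Continuous (docsF s k c) := by
  unfold docsF
  refine Continuous.mul ?_ (by fun_prop)
  exact Continuous.rpow_const (by fun_prop) (fun x => Or.inr hk.le)

lemma docsF_deriv (s k c u : ℝ) (hs : s < 1) (hu : s < u) :
    HasDerivAt (docsF s k c) (-((-k) / (u - s) + c) * docsF s k c u) u := by
  have h1 : 0 < 1 - s := by linarith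
  have h2 : 0 < u - s := by linarith
  have hb : 0 < (u - s) / (1 - s) := div_pos h2 h1
  have e1 : HasDerivAt (fun u : ℝ => (u - s) / (1 - s)) (1 / (1 - s)) u :=
    ((hasDerivAt_id u).sub_const s).div_const (1 - s)
  have e2 := e1.rpow_const (p := k) (Or.inl hb.ne')
  have e3 : HasDerivAt (fun u : ℝ => c * (1 - u)) (c * (-1)) u :=
    ((hasDerivAt_id u).const_sub 1).const_mul c
  have e4 := e2.mul e3.exp
  refine e4.congr_deriv ?_
  unfold docsF
  rw [Real.rpow_sub_one hb.ne']
  field_simp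
  ring

lemma docsF_eq (s k c u : ℝ) (hs : s < 1) (hu : s < u) (hu1 : u ≤ 1) (h : ℝ → ℝ)
    (hh : ∀ y, s < y → h y = (-k) / (y - s) + c) :
    Real.exp (∫ z in u..(1:ℝ), h z) = docsF s k c u := by
  have h1 : 0 < 1 - s := by linarith
  have h2 : 0 < u - s := by linarith
  have hb : 0 < (u - s) / (1 - s) := div_pos h2 h1
  have key : ∫ z in u..(1:ℝ), h z =
      ((-k) * Real.log (1 - s) + c * 1) - ((-k) * Real.log (u - s) + c * u) := by
    have hd : ∀ z ∈ Set.uIcc u 1, HasDerivAt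
        (fun z : ℝ => (-k) * Real.log (z - s) + c * z) (h z) z := by
      intro z hz
      rw [Set.uIcc_of_le hu1] at hz
      have hz' : s < z := lt_of_lt_of_le hu hz.1
      have e := ((((hasDerivAt_id z).sub_const s).log (by simp; linarith)).const_mul (-k)).add
        ((hasDerivAt_id z).const_mul c)
      refine e.congr_deriv ?_
      rw [hh z hz']
      simp
      ring
    refine integral_eq_sub_of_hasDerivAt hd ?_
    apply ContinuousOn.intervalIntegrable
    rw [Set.uIcc_of_le hu1]
    have : ContinuousOn (fun y : ℝ => (-k) / (y - s) + c) (Set.Icc u 1) := by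
      refine ContinuousOn.add (ContinuousOn.div (by fun_prop) (by fun_prop) ?_) (by fun_prop)
      intro y hy
      have := hy.1
      linarith
    refine this.congr ?_
    intro y hy
    exact hh y (lt_of_lt_of_le hu hy.1)
  rw [key]
  unfold docsF
  rw [Real.rpow_def_of_pos hb, ← Real.exp_add, Real.log_div h2.ne' h1.ne']
  congr 1
  ring

/-- The function `u ↦ g(u)·exp(∫_u^1 h)` is integrable on `(y*, 1)` with
`y* = ν/(ν+α)`, and any bounded differentiable `Ψ : (y*, 1] → ℝ` satisfying
`Ψ'(y) = h(y)·Ψ(y) − g(y)` on `(y*, 1]` has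
`Ψ(1) = −∫_{y*}^{1} g(u)·exp(∫_u^1 h) du`. -/
theorem stmt11 (lam mu nu alpha p q : ℝ)
    (hlam : 0 < lam) (hmu : 0 < mu) (hnu : 0 < nu) (halpha : 0 < alpha)
    (hp0 : 0 ≤ p) (hp1 : p ≤ 1) (hq : q = 1 - p) :
    IntegrableOn
      (fun u => docsG lam nu alpha p q u *
        Real.exp (∫ z in u..(1:ℝ), docsH lam mu nu alpha p z))
      (Set.Ioo (nu / (nu + alpha)) 1) volume ∧
    ∀ Ψ : ℝ → ℝ,
      (∃ M : ℝ, ∀ y ∈ Set.Ioc (nu / (nu + alpha)) 1, |Ψ y| ≤ M) →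
      (∀ y ∈ Set.Ioc (nu / (nu + alpha)) 1,
        HasDerivWithinAt Ψ
          (docsH lam mu nu alpha p y * Ψ y - docsG lam nu alpha p q y)
          (Set.Ioc (nu / (nu + alpha)) 1) y) →
      Ψ 1 = -∫ u in (nu / (nu + alpha))..(1:ℝ),
          docsG lam nu alpha p q u *
            Real.exp (∫ z in u..(1:ℝ), docsH lam mu nu alpha p z) := by
  set s := nu / (nu + alpha) with hs_def
  have ha : 0 < nu + alpha := by linarith
  have hs : s < 1 := by rw [hs_def, div_lt_one ha]; linarith
  have hsa : s * (nu + alpha) = nu := by rw [hs_def]; field_simp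
  set c := lam * p / (nu + alpha) with hc
  set k := (lam * p * (1 - s) + mu) / (nu + alpha) with hk_def
  have hlp : 0 ≤ lam * p := mul_nonneg hlam.le hp0
  have hk : 0 < k := by
    have := mul_nonneg hlp (sub_nonneg.2 hs.le)
    apply div_pos _ ha
    linarith
  have hD : ∀ y, nu * (1 - y) - alpha * y = -((nu + alpha) * (y - s)) := by
    intro y; linear_combination (-1 : ℝ) * hsa
  have hh : ∀ y, s < y → docsH lam mu nu alpha p y = (-k) / (y - s) + c := by
    intro y hy
    have : y - s ≠ 0 := by linarith
    unfold docsH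
    rw [hD, hk_def, hc]
    field_simp
    ring
  have hE : ∀ u ∈ Set.Ioc s 1,
      Real.exp (∫ z in u..(1:ℝ), docsH lam mu nu alpha p z) = docsF s k c u :=
    fun u hu => docsF_eq s k c u hs hu.1 hu.2 _ hh
  have hF0 : ∀ u, s < u → 0 ≤ docsF s k c u := by
    intro u hu
    unfold docsF
    have : 0 ≤ (u - s) / (1 - s) := div_nonneg (by linarith) (by linarith)
    positivity
  have hFc := docsF_cont s k c hk
  have hhneg : ∀ y ∈ Set.Ioc s 1, docsH lam mu nu alpha p y ≤ 0 := by
    intro y hy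
    unfold docsH
    rw [hD]
    apply div_nonpos_of_nonneg_of_nonpos
    · have := mul_nonneg hlp (sub_nonneg.2 hy.2)
      linarith
    · have := mul_pos ha (sub_pos.2 hy.1)
      linarith
  have hIH : IntegrableOn (fun u => -docsH lam mu nu alpha p u * docsF s k c u)
      (Set.Ioc s 1) volume := by
    refine integrableOn_deriv_of_nonneg hFc.continuousOn (g := docsF s k c) ?_ ?_
    · intro x hx
      have := docsF_deriv s k c x hs hx.1
      rwa [← hh x hx.1] at this
    · intro x hx
      exact mul_nonneg (by linarith [hhneg x ⟨hx.1, hx.2.le⟩]) (hF0 x hx.1)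
  have hIG : IntegrableOn (fun u => docsG lam nu alpha p q u * docsF s k c u)
      (Set.Ioc s 1) volume := by
    refine (hIH.const_mul (lam * q / mu)).mono' ?_ ?_
    · apply Measurable.aestronglyMeasurable
      refine Measurable.mul ?_ hFc.measurable
      unfold docsG
      fun_prop
    · refine (ae_restrict_iff' measurableSet_Ioc).2 (Filter.Eventually.of_forall ?_)
      intro y hy
      have hF := hF0 y hy.1
      have hq0 : 0 ≤ lam * q := mul_nonneg hlam.le (by linarith)
      have hd : 0 < (nu + alpha) * (y - s) := mul_pos ha (sub_pos.2 hy.1)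
      have hn := mul_nonneg hlp (sub_nonneg.2 hy.2)
      have hexp : Real.exp (-(lam * p / nu) * (1 - y)) ≤ 1 := by
        rw [Real.exp_le_one_iff]
        have := mul_nonneg (div_nonneg hlp hnu.le) (sub_nonneg.2 hy.2)
        linarith
      rw [norm_mul, Real.norm_of_nonneg hF, ← mul_assoc]
      refine mul_le_mul_of_nonneg_right ?_ hF
      unfold docsG docsH
      rw [hD, div_neg, div_neg, neg_neg, norm_neg, Real.norm_of_nonneg (by positivity),
        ← mul_div_assoc]
      refine div_le_div_of_nonneg_right ?_ hd.le
      have e1 : lam * q * Real.exp (-(lam * p / nu) * (1 - y)) ≤ lam * q :=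
        mul_le_of_le_one_right hq0 hexp
      have e2 : lam * q / mu * mu ≤ lam * q / mu * (lam * p * (1 - y) + mu) :=
        mul_le_mul_of_nonneg_left (by linarith) (by positivity)
      have e3 : lam * q / mu * mu = lam * q := by field_simp
      linarith
  constructor
  · refine (hIG.mono_set Set.Ioo_subset_Ioc_self).congr_fun ?_ measurableSet_Ioo
    intro u hu
    simp only [hE u ⟨hu.1, hu.2.le⟩]
  · rintro Ψ ⟨M, hM⟩ hΨ
    have hint : ∫ u in s..(1:ℝ), docsG lam nu alpha p q u *
            Real.exp (∫ z in u..(1:ℝ), docsH lam mu nu alpha p z) =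
        ∫ u in s..(1:ℝ), docsG lam nu alpha p q u * docsF s k c u := by
      rw [integral_of_le hs.le, integral_of_le hs.le]
      refine setIntegral_congr_fun measurableSet_Ioc ?_
      intro u hu
      simp only [hE u hu]
    rw [hint, ← intervalIntegral.integral_neg]
    have hFs : docsF s k c s = 0 := by
      unfold docsF
      simp [Real.zero_rpow hk.ne']
    have hF1 : docsF s k c 1 = 1 := by
      unfold docsF
      rw [div_self (by linarith)]
      simp
    have hcont : ContinuousOn (fun u => Ψ u * docsF s k c u) (Set.Icc s 1) := by
      intro x hx
      rcases hx.1.eq_or_lt with rfl | hlt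
      · have hlim : Filter.Tendsto (fun u => (max M |Ψ s|) * |docsF s k c u|)
            (nhdsWithin s (Set.Icc s 1)) (nhds 0) := by
          have : Continuous (fun u => (max M |Ψ s|) * |docsF s k c u|) := by fun_prop
          have h2 := this.tendsto s
          simp only [hFs, abs_zero, mul_zero] at h2
          exact h2.mono_left nhdsWithin_le_nhds
        unfold ContinuousWithinAt
        simp only [hFs, mul_zero]
        refine squeeze_zero_norm' ?_ hlim
        filter_upwards [self_mem_nhdsWithin] with u hu
        rw [norm_mul, Real.norm_eq_abs, Real.norm_eq_abs]
        refine mul_le_mul_of_nonneg_right ?_ (abs_nonneg _)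
        rcases hu.1.eq_or_lt with h | h
        · rw [← h]; exact le_max_right _ _
        · exact (hM u ⟨h, hu.2⟩).trans (le_max_left _ _)
      · have h1 := (hΨ x ⟨hlt, hx.2⟩).continuousWithinAt
        have h2 : ContinuousWithinAt Ψ (Set.Icc s 1) x := by
          refine h1.mono_of_mem_nhdsWithin ?_
          filter_upwards [self_mem_nhdsWithin, nhdsWithin_le_nhds (Ioi_mem_nhds hlt)] with u hu hu'
          exact ⟨hu', hu.2⟩
        exact h2.mul hFc.continuousWithinAt
    rw [integral_eq_sub_of_hasDerivAt_of_le hs.le hcont]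
    · simp [hFs, hF1]
    · intro x hx
      have h1 := (hΨ x ⟨hx.1, hx.2.le⟩).hasDerivAt (Ioc_mem_nhds hx.1 hx.2)
      have h2 := docsF_deriv s k c x hs hx.1
      rw [← hh x hx.1] at h2
      refine (h1.mul h2).congr_deriv ?_
      ring
    · exact ((intervalIntegrable_iff_integrableOn_Ioc_of_le hs.le).2 hIG).neg
end

section
/- Let Φ : ℝ² → ℝ be three times continuously differentiable on an open neighborhood of (1,1), satisfy Φ(1,1) = 1, and satisfy the SIS reactor PDE on that neighborhood. Then λp + α·Φ_{xy}(1,1) = (μ + β)·Φ_y(1,1). -/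
/-- Partial derivative in the first variable of a function `Φ : ℝ² → ℝ`. -/
noncomputable def pdx (Φ : ℝ × ℝ → ℝ) (z : ℝ × ℝ) : ℝ :=
  deriv (fun s => Φ (s, z.2)) z.1

/-- Partial derivative in the second variable of a function `Φ : ℝ² → ℝ`. -/
noncomputable def pdy (Φ : ℝ × ℝ → ℝ) (z : ℝ × ℝ) : ℝ :=
  deriv (fun t => Φ (z.1, t)) z.2

theorem pd_contDiffOn_aux {Φ : ℝ × ℝ → ℝ} {U : Set (ℝ × ℝ)} (hU : IsOpen U) {m n : ℕ}
    (hmn : m + 1 ≤ n) (h : ContDiffOn ℝ n Φ U) :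
    ContDiffOn ℝ m (pdx Φ) U ∧ ContDiffOn ℝ m (pdy Φ) U := by
  have hf : ContDiffOn ℝ m (fderiv ℝ Φ) U :=
    h.fderiv_of_isOpen hU (by exact_mod_cast hmn)
  have hd : ∀ z ∈ U, HasFDerivAt Φ (fderiv ℝ Φ z) z := fun z hz =>
    ((h.contDiffAt (hU.mem_nhds hz)).differentiableAt (by
      have : n ≠ 0 := by omega
      exact_mod_cast this)).hasFDerivAt
  constructor
  · refine (hf.clm_apply (contDiffOn_const (c := ((1:ℝ), (0:ℝ))))).congr fun z hz => ?_
    have h1 : HasDerivAt (fun s : ℝ => (s, z.2)) ((1:ℝ), (0:ℝ)) z.1 :=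
      (hasDerivAt_id z.1).prodMk (hasDerivAt_const _ _)
    exact (HasFDerivAt.comp_hasDerivAt (f := fun s : ℝ => (s, z.2)) z.1 (hd z hz) h1).deriv
  · refine (hf.clm_apply (contDiffOn_const (c := ((0:ℝ), (1:ℝ))))).congr fun z hz => ?_
    have h1 : HasDerivAt (fun s : ℝ => (z.1, s)) ((0:ℝ), (1:ℝ)) z.2 :=
      (hasDerivAt_const _ _).prodMk (hasDerivAt_id z.2)
    exact (HasFDerivAt.comp_hasDerivAt (f := fun s : ℝ => (z.1, s)) z.2 (hd z hz) h1).deriv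

/-- Let `Φ : ℝ² → ℝ` be `C³` on an open neighborhood of `(1,1)`, with
`Φ(1,1) = 1`, satisfying the SIS reactor PDE
`(λq(1−x) + λp(1−y))·Φ = μ(1−x)·Φ_x + (μ(1−y) + β(x−y))·Φ_y + αy(y−x)·Φ_{xy}` there.
Then `λp + α·Φ_{xy}(1,1) = (μ + β)·Φ_y(1,1)`. -/
theorem stmt12 (lam mu alpha beta p q : ℝ)
    (hlam : 0 < lam) (hmu : 0 < mu) (halpha : 0 < alpha) (hbeta : 0 < beta)
    (hp0 : 0 ≤ p) (hp1 : p ≤ 1) (hq : q = 1 - p)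
    (Φ : ℝ × ℝ → ℝ) (U : Set (ℝ × ℝ)) (hU : IsOpen U) (hmem : ((1:ℝ), (1:ℝ)) ∈ U)
    (hC3 : ContDiffOn ℝ 3 Φ U) (hΦ11 : Φ (1, 1) = 1)
    (hPDE : ∀ z ∈ U,
      (lam * q * (1 - z.1) + lam * p * (1 - z.2)) * Φ z =
        mu * (1 - z.1) * pdx Φ z +
          (mu * (1 - z.2) + beta * (z.1 - z.2)) * pdy Φ z +
          alpha * z.2 * (z.2 - z.1) * pdx (pdy Φ) z) :
    lam * p + alpha * pdx (pdy Φ) (1, 1) = (mu + beta) * pdy Φ (1, 1) := by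
  have hy : ContDiffOn ℝ (2:ℕ) (pdy Φ) U :=
    (pd_contDiffOn_aux hU (n := 3) (by norm_num) (by exact_mod_cast hC3)).2
  have hxy : ContDiffOn ℝ (1:ℕ) (pdx (pdy Φ)) U :=
    (pd_contDiffOn_aux hU (by norm_num) hy).1
  have hUn := hU.mem_nhds hmem
  have hl : ContinuousAt (fun y : ℝ => ((1:ℝ), y)) 1 := by fun_prop
  have c0 : ContinuousAt (fun y : ℝ => Φ (1, y)) 1 :=
    ContinuousAt.comp (f := fun y : ℝ => ((1:ℝ), y)) (hC3.continuousOn.continuousAt hUn) hl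
  have c1 : ContinuousAt (fun y : ℝ => pdy Φ (1, y)) 1 :=
    ContinuousAt.comp (f := fun y : ℝ => ((1:ℝ), y)) (hy.continuousOn.continuousAt hUn) hl
  have c2 : ContinuousAt (fun y : ℝ => pdx (pdy Φ) (1, y)) 1 :=
    ContinuousAt.comp (f := fun y : ℝ => ((1:ℝ), y)) (hxy.continuousOn.continuousAt hUn) hl
  have cL : ContinuousAt (fun y : ℝ => lam * p * Φ (1, y) + alpha * y * pdx (pdy Φ) (1, y)) 1 :=
    (continuousAt_const.mul c0).add ((continuousAt_const.mul continuousAt_id).mul c2)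
  have cR : ContinuousAt (fun y : ℝ => (mu + beta) * pdy Φ (1, y)) 1 :=
    continuousAt_const.mul c1
  have hev : (fun y : ℝ => lam * p * Φ (1, y) + alpha * y * pdx (pdy Φ) (1, y))
      =ᶠ[nhdsWithin 1 {1}ᶜ] (fun y : ℝ => (mu + beta) * pdy Φ (1, y)) := by
    filter_upwards [self_mem_nhdsWithin, mem_nhdsWithin_of_mem_nhds (hl.preimage_mem_nhds hUn)]
      with y hne hyU
    have h := hPDE (1, y) hyU
    have hne' : (1 - y) ≠ 0 := sub_ne_zero.mpr (Ne.symm hne)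
    apply mul_left_cancel₀ hne'
    simp only at h
    linear_combination h
  have := tendsto_nhds_unique ((cL.tendsto.mono_left nhdsWithin_le_nhds).congr' hev)
    (cR.tendsto.mono_left nhdsWithin_le_nhds)
  simpa [hΦ11] using this
end

section
/- Let Φ : ℝ² → ℝ be three times continuously differentiable on an open neighborhood of (1,1), satisfy Φ(1,1) = 1, and satisfy the SIS reactor PDE on that neighborhood. Then (λp + μ + β)·Φ_y(1,1) + α·(Φ_{xyy}(1,1) + Φ_{xy}(1,1)) = (μ + β)·(Φ_{yy}(1,1) + Φ_y(1,1)). -/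
theorem aux_pdx {f : ℝ × ℝ → ℝ} {z : ℝ × ℝ} (h : DifferentiableAt ℝ f z) :
    HasDerivAt (fun s => f (s, z.2)) (fderiv ℝ f z (1, 0)) z.1 := by
  have h1 : HasDerivAt (fun s : ℝ => (s, z.2)) ((1 : ℝ), (0 : ℝ)) z.1 :=
    (hasDerivAt_id z.1).prodMk (hasDerivAt_const z.1 z.2)
  exact HasFDerivAt.comp_hasDerivAt (x := z.1) (f := fun s : ℝ => (s, z.2)) h.hasFDerivAt h1

theorem aux_pdy {f : ℝ × ℝ → ℝ} {z : ℝ × ℝ} (h : DifferentiableAt ℝ f z) :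
    HasDerivAt (fun t => f (z.1, t)) (fderiv ℝ f z (0, 1)) z.2 := by
  have h1 : HasDerivAt (fun t : ℝ => (z.1, t)) ((0 : ℝ), (1 : ℝ)) z.2 :=
    (hasDerivAt_const z.2 z.1).prodMk (hasDerivAt_id z.2)
  exact HasFDerivAt.comp_hasDerivAt (x := z.2) (f := fun t : ℝ => (z.1, t)) h.hasFDerivAt h1

theorem aux_diff {f : ℝ × ℝ → ℝ} {U : Set (ℝ × ℝ)} (hU : IsOpen U) {n : ℕ}
    (h : ContDiffOn ℝ (n + 1 : ℕ) f U) {z : ℝ × ℝ} (hz : z ∈ U) : DifferentiableAt ℝ f z :=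
  (h.contDiffAt (hU.mem_nhds hz)).differentiableAt (by norm_cast)

theorem aux_cx {f : ℝ × ℝ → ℝ} {U : Set (ℝ × ℝ)} (hU : IsOpen U) {n : ℕ}
    (h : ContDiffOn ℝ (n + 1 : ℕ) f U) : ContDiffOn ℝ n (pdx f) U := by
  have h1 : ContDiffOn ℝ n (fderiv ℝ f) U := h.fderiv_of_isOpen hU (by norm_cast)
  refine (h1.clm_apply (contDiffOn_const (c := ((1 : ℝ), (0 : ℝ))))).congr ?_
  intro z hz
  exact (aux_pdx (aux_diff hU h hz)).deriv

theorem aux_cy {f : ℝ × ℝ → ℝ} {U : Set (ℝ × ℝ)} (hU : IsOpen U) {n : ℕ}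
    (h : ContDiffOn ℝ (n + 1 : ℕ) f U) : ContDiffOn ℝ n (pdy f) U := by
  have h1 : ContDiffOn ℝ n (fderiv ℝ f) U := h.fderiv_of_isOpen hU (by norm_cast)
  refine (h1.clm_apply (contDiffOn_const (c := ((0 : ℝ), (1 : ℝ))))).congr ?_
  intro z hz
  exact (aux_pdy (aux_diff hU h hz)).deriv

theorem aux_symm {f : ℝ × ℝ → ℝ} {U : Set (ℝ × ℝ)} (hU : IsOpen U)
    (h : ContDiffOn ℝ (1 + 1 : ℕ) f U) {z : ℝ × ℝ} (hz : z ∈ U) :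
    pdx (pdy f) z = pdy (pdx f) z := by
  have hx := aux_cx hU h
  have hy := aux_cy hU h
  have h1 : ContDiffOn ℝ 1 (fderiv ℝ f) U := h.fderiv_of_isOpen hU (by norm_cast)
  have hd : DifferentiableAt ℝ (fderiv ℝ f) z :=
    (h1.contDiffAt (hU.mem_nhds hz)).differentiableAt (by norm_num)
  have ex : pdx f =ᶠ[nhds z] fun w => fderiv ℝ f w (1, 0) := by
    filter_upwards [hU.mem_nhds hz] with w hw
    exact (aux_pdx (aux_diff hU h hw)).deriv
  have ey : pdy f =ᶠ[nhds z] fun w => fderiv ℝ f w (0, 1) := by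
    filter_upwards [hU.mem_nhds hz] with w hw
    exact (aux_pdy (aux_diff hU h hw)).deriv
  have e1 : pdx (pdy f) z = fderiv ℝ (pdy f) z (1, 0) :=
    (aux_pdx (aux_diff (n := 0) hU (by simpa using hy) hz)).deriv
  have e2 : pdy (pdx f) z = fderiv ℝ (pdx f) z (0, 1) :=
    (aux_pdy (aux_diff (n := 0) hU (by simpa using hx) hz)).deriv
  have key : ∀ v w : ℝ × ℝ,
      fderiv ℝ (fun u => fderiv ℝ f u v) z w = fderiv ℝ (fderiv ℝ f) z w v := by
    intro v w
    rw [fderiv_clm_apply hd (differentiableAt_const v)]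
    simp
  rw [e1, e2, ex.fderiv_eq, ey.fderiv_eq, key, key]
  exact ((h.contDiffAt (hU.mem_nhds hz)).isSymmSndFDerivAt (by simp)) _ _

/-- Let `Φ : ℝ² → ℝ` be `C³` on an open neighborhood of `(1,1)`, with
`Φ(1,1) = 1`, satisfying the SIS reactor PDE there. Then
`(λp + μ + β)·Φ_y(1,1) + α·(Φ_{xyy}(1,1) + Φ_{xy}(1,1))
  = (μ + β)·(Φ_{yy}(1,1) + Φ_y(1,1))`. -/
theorem stmt13 (lam mu alpha beta p q : ℝ)
    (hlam : 0 < lam) (hmu : 0 < mu) (halpha : 0 < alpha) (hbeta : 0 < beta)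
    (hp0 : 0 ≤ p) (hp1 : p ≤ 1) (hq : q = 1 - p)
    (Φ : ℝ × ℝ → ℝ) (U : Set (ℝ × ℝ)) (hU : IsOpen U) (hmem : ((1:ℝ), (1:ℝ)) ∈ U)
    (hC3 : ContDiffOn ℝ 3 Φ U) (hΦ11 : Φ (1, 1) = 1)
    (hPDE : ∀ z ∈ U,
      (lam * q * (1 - z.1) + lam * p * (1 - z.2)) * Φ z =
        mu * (1 - z.1) * pdx Φ z +
          (mu * (1 - z.2) + beta * (z.1 - z.2)) * pdy Φ z +
          alpha * z.2 * (z.2 - z.1) * pdx (pdy Φ) z) :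
    (lam * p + mu + beta) * pdy Φ (1, 1) +
        alpha * (pdx (pdy (pdy Φ)) (1, 1) + pdx (pdy Φ) (1, 1)) =
      (mu + beta) * (pdy (pdy Φ) (1, 1) + pdy Φ (1, 1)) := by
  have hc3 : ContDiffOn ℝ (2 + 1 : ℕ) Φ U := by exact_mod_cast hC3
  have hc2 : ContDiffOn ℝ (1 + 1 : ℕ) (pdy Φ) U := aux_cy hU hc3
  have hc1 : ContDiffOn ℝ (0 + 1 : ℕ) (pdx (pdy Φ)) U := aux_cx hU hc2
  have d0 := (aux_pdy (aux_diff hU hc3 hmem)).differentiableAt.hasDerivAt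
  have d1 := (aux_pdy (aux_diff hU hc2 hmem)).differentiableAt.hasDerivAt
  have d2 := (aux_pdy (aux_diff hU hc1 hmem)).differentiableAt.hasDerivAt
  change HasDerivAt (fun t => Φ (1, t)) (pdy Φ (1, 1)) 1 at d0
  change HasDerivAt (fun t => pdy Φ (1, t)) (pdy (pdy Φ) (1, 1)) 1 at d1
  change HasDerivAt (fun t => pdx (pdy Φ) (1, t)) (pdy (pdx (pdy Φ)) (1, 1)) 1 at d2
  rw [← aux_symm hU hc2 hmem] at d2
  have dF := ((d0.const_mul (lam * p)).sub (d1.const_mul (mu + beta))).add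
    (((hasDerivAt_id (1 : ℝ)).mul d2).const_mul alpha)
  have hev : ∀ᶠ t in nhds (1 : ℝ), ((1 : ℝ), t) ∈ U :=
    (Continuous.prodMk_right (1 : ℝ)).continuousAt.eventually_mem (hU.mem_nhds hmem)
  have hne := (dF.continuousAt.eventuallyEq_nhds_iff_eventuallyEq_nhdsNE
    (continuousAt_const (y := (0 : ℝ)))).1 (by
      filter_upwards [hev.filter_mono nhdsWithin_le_nhds, self_mem_nhdsWithin] with t ht ht1
      have h := hPDE _ ht
      have h1 : (1 - t) ≠ 0 := sub_ne_zero.2 (Ne.symm ht1)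
      apply mul_left_cancel₀ h1
      simp only [Pi.add_apply, Pi.sub_apply, Pi.mul_apply, id] at h ⊢
      linear_combination h)
  have h0 := dF.unique ((hasDerivAt_const (1 : ℝ) (0 : ℝ)).congr_of_eventuallyEq hne)
  simp only [id] at h0
  linear_combination h0
end

section
/- Let Φ : ℝ² → ℝ be twice continuously differentiable on an open set containing [0,1]², satisfy Φ(1,1) = 1, and satisfy the SIS reactor PDE on that open set. Then for every z ∈ [0,1], Φ(z,z) = exp(−(λ/μ)(1−z)). -/
/-- Let `Φ : ℝ² → ℝ` be `C²` on an open set containing `[0,1]²`, with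
`Φ(1,1) = 1`, satisfying the SIS reactor PDE there. Then for every `z ∈ [0,1]`,
`Φ(z,z) = exp(−(λ/μ)(1−z))`. -/
theorem stmt14 (lam mu alpha beta p q : ℝ)
    (hlam : 0 < lam) (hmu : 0 < mu) (halpha : 0 < alpha) (hbeta : 0 < beta)
    (hp0 : 0 ≤ p) (hp1 : p ≤ 1) (hq : q = 1 - p)
    (Φ : ℝ × ℝ → ℝ) (U : Set (ℝ × ℝ)) (hU : IsOpen U)
    (hsub : Set.Icc (0:ℝ) 1 ×ˢ Set.Icc (0:ℝ) 1 ⊆ U)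
    (hC2 : ContDiffOn ℝ 2 Φ U) (hΦ11 : Φ (1, 1) = 1)
    (hPDE : ∀ z ∈ U,
      (lam * q * (1 - z.1) + lam * p * (1 - z.2)) * Φ z =
        mu * (1 - z.1) * pdx Φ z +
          (mu * (1 - z.2) + beta * (z.1 - z.2)) * pdy Φ z +
          alpha * z.2 * (z.2 - z.1) * pdx (pdy Φ) z) :
    ∀ z ∈ Set.Icc (0:ℝ) 1, Φ (z, z) = Real.exp (-(lam / mu) * (1 - z)) := by
  intro z hz
  have hd : ∀ t ∈ Set.Icc (0:ℝ) 1, DifferentiableAt ℝ Φ (t, t) := fun t ht =>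
    (hC2.differentiableOn (by norm_num)).differentiableAt (hU.mem_nhds (hsub ⟨ht, ht⟩))
  have hg : ∀ t ∈ Set.Icc (0:ℝ) 1,
      HasDerivAt (fun s => Φ (s, s)) (pdx Φ (t, t) + pdy Φ (t, t)) t := by
    intro t ht
    have hF := (hd t ht).hasFDerivAt
    have h1 : HasDerivAt (fun s : ℝ => (s, t)) ((1:ℝ), (0:ℝ)) t :=
      (hasDerivAt_id t).prodMk (hasDerivAt_const t t)
    have h2 : HasDerivAt (fun s : ℝ => (t, s)) ((0:ℝ), (1:ℝ)) t :=
      (hasDerivAt_const t t).prodMk (hasDerivAt_id t)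
    have h3 : HasDerivAt (fun s : ℝ => (s, s)) ((1:ℝ), (1:ℝ)) t :=
      (hasDerivAt_id t).prodMk (hasDerivAt_id t)
    have e1 : pdx Φ (t, t) = fderiv ℝ Φ (t, t) (1, 0) :=
      (HasFDerivAt.comp_hasDerivAt (f := fun s : ℝ => (s, t)) t hF h1).deriv
    have e2 : pdy Φ (t, t) = fderiv ℝ Φ (t, t) (0, 1) :=
      (HasFDerivAt.comp_hasDerivAt (f := fun s : ℝ => (t, s)) t hF h2).deriv
    have h := HasFDerivAt.comp_hasDerivAt (f := fun s : ℝ => (s, s)) t hF h3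
    rw [e1, e2, ← map_add]
    simpa [Function.comp_def] using h
  have hode : ∀ t ∈ Set.Ico (0:ℝ) 1,
      pdx Φ (t, t) + pdy Φ (t, t) = lam / mu * Φ (t, t) := by
    intro t ht
    have ht' : t ∈ Set.Icc (0:ℝ) 1 := ⟨ht.1, ht.2.le⟩
    have h := hPDE (t, t) (hsub ⟨ht', ht'⟩)
    simp only [hq] at h
    have hne : (1 - t) ≠ 0 := by linarith [ht.2]
    have h' : mu * (pdx Φ (t, t) + pdy Φ (t, t)) = lam * Φ (t, t) := by
      apply mul_left_cancel₀ hne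
      linear_combination -h
    field_simp
    linarith
  have hK : ∀ t ∈ Set.Icc (0:ℝ) 1, HasDerivAt (fun s => Φ (s, s) * Real.exp (lam / mu * (1 - s)))
      ((pdx Φ (t, t) + pdy Φ (t, t)) * Real.exp (lam / mu * (1 - t)) +
        Φ (t, t) * (Real.exp (lam / mu * (1 - t)) * (lam / mu * (-1)))) t := by
    intro t ht
    exact (hg t ht).mul ((((hasDerivAt_id t).const_sub 1).const_mul (lam / mu)).exp)
  have hconst := constant_of_has_deriv_right_zero
    (f := fun s => Φ (s, s) * Real.exp (lam / mu * (1 - s))) (a := 0) (b := 1)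
    (fun t ht => (hK t ht).continuousAt.continuousWithinAt)
    (fun t ht => by
      have h := (hK t ⟨ht.1, ht.2.le⟩).hasDerivWithinAt (s := Set.Ici t)
      rw [hode t ht] at h
      convert h using 1
      ring)
  have hz0 := hconst z hz
  have h10 := hconst 1 ⟨zero_le_one, le_rfl⟩
  have hfin : Φ (z, z) * Real.exp (lam / mu * (1 - z)) = 1 := by
    have h := hz0.trans h10.symm
    simpa [hΦ11] using h
  rw [neg_mul, Real.exp_neg]
  exact eq_inv_of_mul_eq_one_left hfin
end

section
/- Let λ, μ, ν, α > 0, p ∈ [0,1], q = 1 − p, θ = λp/ν, and let Φ : ℝ² → ℝ be three times continuously differentiable on an open set containing {1} × [0,1], satisfy Φ(1,1) = 1, and satisfy the DOCS reactor PDE (λq(1−x) + λp(1−y))·Φ(x,y) = μ(1−x)·Φ_x(x,y) + ν(1−y)·Φ_y(x,y) + αy(1−x)·Φ_{xy}(x,y) on that set. Then: (a) Φ(1,y) = exp(−θ(1−y)) for all y ∈ [0,1]; and (b) the function Ψ(y) := Φ_x(1,y) satisfies (ν(1−y) − αy)·Ψ'(y) = (λp(1−y) + μ)·Ψ(y) −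 λq·exp(−θ(1−y)) for all y ∈ [0,1]. -/
lemma hda_x {F : ℝ × ℝ → ℝ} {z : ℝ × ℝ} (h : DifferentiableAt ℝ F z) :
    HasDerivAt (fun s => F (s, z.2)) (fderiv ℝ F z (1, 0)) z.1 := by
  have h1 : HasDerivAt (fun s : ℝ => (s, z.2)) ((1 : ℝ), (0 : ℝ)) z.1 :=
    (hasDerivAt_id z.1).prodMk (hasDerivAt_const z.1 z.2)
  exact HasFDerivAt.comp_hasDerivAt (f := fun s : ℝ => (s, z.2)) z.1 h.hasFDerivAt h1

lemma hda_y {F : ℝ × ℝ → ℝ} {z : ℝ × ℝ} (h : DifferentiableAt ℝ F z) :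
    HasDerivAt (fun t => F (z.1, t)) (fderiv ℝ F z (0, 1)) z.2 := by
  have h1 : HasDerivAt (fun t : ℝ => (z.1, t)) ((0 : ℝ), (1 : ℝ)) z.2 :=
    (hasDerivAt_const z.2 z.1).prodMk (hasDerivAt_id z.2)
  exact HasFDerivAt.comp_hasDerivAt (f := fun t : ℝ => (z.1, t)) z.2 h.hasFDerivAt h1

lemma cd_dir {F : ℝ × ℝ → ℝ} {U : Set (ℝ × ℝ)} (hU : IsOpen U) {m n : WithTop ℕ∞}
    (h : ContDiffOn ℝ n F U) (hmn : m + 1 ≤ n) (v : ℝ × ℝ) :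
    ContDiffOn ℝ m (fun z => fderiv ℝ F z v) U :=
  (h.fderiv_of_isOpen hU hmn).clm_apply contDiffOn_const

/-- Let `λ, μ, ν, α > 0`, `p ∈ [0,1]`, `q = 1 − p`, `θ = λp/ν`, and let
`Φ : ℝ² → ℝ` be `C³` on an open set containing `{1} × [0,1]`, with `Φ(1,1) = 1`,
satisfying the DOCS reactor PDE
`(λq(1−x) + λp(1−y))·Φ = μ(1−x)·Φ_x + ν(1−y)·Φ_y + αy(1−x)·Φ_{xy}` there. Then:
(a) `Φ(1,y) = exp(−θ(1−y))` for all `y ∈ [0,1]`;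
(b) `Ψ(y) := Φ_x(1,y)` satisfies
`(ν(1−y) − αy)·Ψ'(y) = (λp(1−y) + μ)·Ψ(y) − λq·exp(−θ(1−y))` for all `y ∈ [0,1]`. -/
theorem stmt15 (lam mu nu alpha p q : ℝ)
    (hlam : 0 < lam) (hmu : 0 < mu) (hnu : 0 < nu) (halpha : 0 < alpha)
    (hp0 : 0 ≤ p) (hp1 : p ≤ 1) (hq : q = 1 - p)
    (Φ : ℝ × ℝ → ℝ) (U : Set (ℝ × ℝ)) (hU : IsOpen U)
    (hsub : ({(1:ℝ)} : Set ℝ) ×ˢ Set.Icc (0:ℝ) 1 ⊆ U)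
    (hC3 : ContDiffOn ℝ 3 Φ U) (hΦ11 : Φ (1, 1) = 1)
    (hPDE : ∀ z ∈ U,
      (lam * q * (1 - z.1) + lam * p * (1 - z.2)) * Φ z =
        mu * (1 - z.1) * pdx Φ z + nu * (1 - z.2) * pdy Φ z +
          alpha * z.2 * (1 - z.1) * pdx (pdy Φ) z) :
    (∀ y ∈ Set.Icc (0:ℝ) 1, Φ (1, y) = Real.exp (-(lam * p / nu) * (1 - y))) ∧
    (∀ y ∈ Set.Icc (0:ℝ) 1,
      (nu * (1 - y) - alpha * y) * deriv (fun t => pdx Φ (1, t)) y =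
        (lam * p * (1 - y) + mu) * pdx Φ (1, y) -
          lam * q * Real.exp (-(lam * p / nu) * (1 - y))) := by
  have dOn : ∀ {F : ℝ × ℝ → ℝ} {n : WithTop ℕ∞}, ContDiffOn ℝ n F U → n ≠ 0 →
      ∀ z ∈ U, DifferentiableAt ℝ F z := fun h hn z hz =>
    (h.differentiableOn hn).differentiableAt (hU.mem_nhds hz)
  set A : ℝ × ℝ → ℝ := fun z => fderiv ℝ Φ z (1, 0) with hA
  set B : ℝ × ℝ → ℝ := fun z => fderiv ℝ Φ z (0, 1) with hB
  set C : ℝ × ℝ → ℝ := fun z => fderiv ℝ B z (1, 0) with hC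
  have cA : ContDiffOn ℝ 2 A U := cd_dir hU hC3 (by norm_num) _
  have cB : ContDiffOn ℝ 2 B U := cd_dir hU hC3 (by norm_num) _
  have cC : ContDiffOn ℝ 1 C U := cd_dir hU cB (by norm_num) _
  have dΦ := dOn hC3 (by norm_num)
  have dA := dOn cA (by norm_num)
  have dB := dOn cB (by norm_num)
  have dC := dOn cC (by norm_num)
  have eA : ∀ z ∈ U, pdx Φ z = A z := fun z hz => (hda_x (dΦ z hz)).deriv
  have eB : ∀ z ∈ U, pdy Φ z = B z := fun z hz => (hda_y (dΦ z hz)).deriv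
  have nx : ∀ z ∈ U, ∀ᶠ s in nhds z.1, (s, z.2) ∈ U := fun z hz =>
    (Continuous.prodMk_left z.2).continuousAt.eventually (hU.mem_nhds hz)
  have ny : ∀ z ∈ U, ∀ᶠ t in nhds z.2, (z.1, t) ∈ U := fun z hz =>
    (Continuous.prodMk_right z.1).continuousAt.eventually (hU.mem_nhds hz)
  have eC : ∀ z ∈ U, pdx (pdy Φ) z = C z := by
    intro z hz
    have : (fun s => pdy Φ (s, z.2)) =ᶠ[nhds z.1] fun s => B (s, z.2) := by
      filter_upwards [nx z hz] with s hs using eB _ hs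
    exact this.deriv_eq.trans (hda_x (dB z hz)).deriv
  have eC' : ∀ z ∈ U, deriv (fun t => pdx Φ (z.1, t)) z.2 = C z := by
    intro z hz
    have : (fun t => pdx Φ (z.1, t)) =ᶠ[nhds z.2] fun t => A (z.1, t) := by
      filter_upwards [ny z hz] with s hs using eA _ hs
    rw [this.deriv_eq, (hda_y (dA z hz)).deriv]
    have hd : DifferentiableAt ℝ (fderiv ℝ Φ) z :=
      ((hC3.fderiv_of_isOpen hU (m := 2) (by norm_num)).differentiableOn
        (by norm_num)).differentiableAt (hU.mem_nhds hz)
    have hs : IsSymmSndFDerivAt ℝ Φ z :=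
      (hC3.contDiffAt (hU.mem_nhds hz)).isSymmSndFDerivAt (by simp; norm_num)
    have h1 : ∀ v w, fderiv ℝ (fun z => fderiv ℝ Φ z v) z w
        = fderiv ℝ (fderiv ℝ Φ) z w v := by
      intro v w
      rw [fderiv_clm_apply hd (differentiableAt_const v)]
      simp
    simp only [hA, hC, hB, h1]
    exact hs.eq _ _
  have mU : ∀ y ∈ Set.Icc (0:ℝ) 1, ((1:ℝ), y) ∈ U := fun y hy => hsub ⟨rfl, hy⟩
  have hPDE' : ∀ z ∈ U, (lam * q * (1 - z.1) + lam * p * (1 - z.2)) * Φ z =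
        mu * (1 - z.1) * A z + nu * (1 - z.2) * B z +
          alpha * z.2 * (1 - z.1) * C z := by
    intro z hz
    rw [← eA z hz, ← eB z hz, ← eC z hz]; exact hPDE z hz
  have ha : ∀ y ∈ Set.Icc (0:ℝ) 1, Φ (1, y) = Real.exp (-(lam * p / nu) * (1 - y)) := by
    have hB1 : ∀ y ∈ Set.Ico (0:ℝ) 1, B (1, y) = lam * p / nu * Φ (1, y) := by
      intro y hy
      have h := hPDE' (1, y) (mU y ⟨hy.1, hy.2.le⟩)
      have hy1 : (1 - y) ≠ 0 := by linarith [hy.2] |> fun h : 0 < 1 - y => h.ne'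
      simp only [sub_self, mul_zero, zero_add, zero_mul, add_zero] at h
      field_simp
      apply mul_left_cancel₀ hy1
      linarith
    have hder : ∀ y ∈ Set.Icc (0:ℝ) 1, HasDerivAt
        (fun t => Φ (1, t) * Real.exp (lam * p / nu * (1 - t)))
        (B (1, y) * Real.exp (lam * p / nu * (1 - y)) +
          Φ (1, y) * (Real.exp (lam * p / nu * (1 - y)) * (lam * p / nu * (-1)))) y := by
      intro y hy
      exact (hda_y (dΦ _ (mU y hy))).mul
        ((((hasDerivAt_id y).const_sub 1).const_mul (lam * p / nu)).exp)
    have key := constant_of_has_deriv_right_zero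
      (f := fun t => Φ (1, t) * Real.exp (lam * p / nu * (1 - t))) (a := 0) (b := 1)
      (fun y hy => (hder y hy).continuousAt.continuousWithinAt)
      (by
        intro y hy
        have h := (hder y ⟨hy.1, hy.2.le⟩).hasDerivWithinAt (s := Set.Ici y)
        rw [hB1 y hy] at h
        convert h using 1
        ring)
    intro y hy
    have k1 := key 1 (by simp)
    have k2 := key y hy
    beta_reduce at k1 k2
    rw [← k1, hΦ11] at k2
    simp only [sub_self, mul_zero, Real.exp_zero, mul_one] at k2
    rw [neg_mul, Real.exp_neg]
    exact eq_inv_of_mul_eq_one_left k2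
  refine ⟨ha, fun y hy => ?_⟩
  have hm := mU y hy
  rw [eC' (1, y) hm, eA _ hm, ← ha y hy]
  have hΦ := hda_x (dΦ _ hm)
  have hAx := hda_x (dA _ hm)
  have hBx := hda_x (dB _ hm)
  have hCx := hda_x (dC _ hm)
  have h1 : HasDerivAt (fun s : ℝ => 1 - s) (-1) 1 := (hasDerivAt_id (1:ℝ)).const_sub 1
  have hL := ((h1.const_mul (lam * q)).add_const (lam * p * (1 - y))).mul hΦ
  have hR := (((h1.const_mul mu).mul hAx).add (hBx.const_mul (nu * (1 - y)))).add
    ((h1.const_mul (alpha * y)).mul hCx)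
  have hE := hL.congr_of_eventuallyEq (f₁ := _) (Filter.EventuallyEq.symm
    (by filter_upwards [nx _ hm] with s hs using hPDE' (s, y) hs))
  have := hE.unique hR
  simp only [hA, hC, sub_self, mul_zero, zero_mul, zero_add, add_zero] at this ⊢
  linarith
end

section
/- Let μ, β, λ, κ > 0 and C > 1 satisfy λκ > Cμβ/(μ+β). Then for every p with 0 < p < (C−1)/(λ/μ + C), one has p·μ/(μ+β) + (1−p)·λpκ/(λp+μ) > p. -/
/-- Let `μ, β, λ, κ > 0` and `C > 1` with `λκ > Cμβ/(μ+β)`. Then for every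
`p` with `0 < p < (C−1)/(λ/μ + C)`, one has
`p·μ/(μ+β) + (1−p)·λpκ/(λp+μ) > p`. -/
theorem stmt19 (mu beta lam kappa C p : ℝ)
    (hmu : 0 < mu) (hbeta : 0 < beta) (hlam : 0 < lam) (hkappa : 0 < kappa)
    (hC : 1 < C) (h : lam * kappa > C * mu * beta / (mu + beta))
    (hp0 : 0 < p) (hp1 : p < (C - 1) / (lam / mu + C)) :
    p * mu / (mu + beta) + (1 - p) * (lam * p * kappa) / (lam * p + mu) > p := by
  have hs : 0 < mu + beta := by positivity
  have hd : 0 < lam * p + mu := by positivity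
  have hC0 : 0 < C := by linarith
  have hq : 0 < lam / mu + C := by positivity
  rw [lt_div_iff₀ hq] at hp1
  have h1 : lam * p + mu < C * mu * (1 - p) := by
    have h2 := mul_lt_mul_of_pos_right hp1 hmu
    have h3 : p * (lam / mu + C) * mu = p * lam + p * C * mu := by
      field_simp
    nlinarith
  have h1p : 0 < 1 - p := by
    have : 0 < C * mu * (1 - p) := lt_trans hd h1
    exact pos_of_mul_pos_right this (by positivity)
  set b := beta / (mu + beta) with hb
  have hb0 : 0 < b := by positivity
  have h' : C * mu * b < lam * kappa := by
    rw [hb, ← mul_div_assoc]; exact h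
  have h4 : b * (lam * p + mu) < (1 - p) * (lam * kappa) := by
    have e1 := mul_lt_mul_of_pos_left h1 hb0
    have e2 := mul_lt_mul_of_pos_left h' h1p
    nlinarith
  have h5 : p * b < (1 - p) * (lam * p * kappa) / (lam * p + mu) := by
    rw [lt_div_iff₀ hd]
    have := mul_lt_mul_of_pos_left h4 hp0
    nlinarith
  have h6 : p * mu / (mu + beta) = p - p * b := by
    rw [hb]; field_simp; ring
  linarith
end
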